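/- Let d, N ≥ 1, T > 0, and let G : P_2(ℝ^d) → ℝ be Lipschitz continuous with respect to d_1 with constant L_G. Fix t ∈ [0,T) and x ∈ (ℝ^d)^N, and let ν̄ ∈ P_2(ℝ^d) be any minimizer, i.e. G(ν̄) + d_2(m_x^N, ν̄)²/(2(T−t)) = U(t, m_x^N). Then d_2(m_x^N, ν̄) ≤ 2 L_G (T−t), and moreover V^N(t, x) ≤ U(t, m_x^N) + 2 L_G² (T−t). -/

import Mathlib

open MeasureTheory Filter
open scoped ENNReal NNReal BigOperators

noncomputable section

/-- `Ed d` is the Euclidean space `ℝ^d`. -/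
abbrev Ed (d : ℕ) := EuclideanSpace ℝ (Fin d)

/-- A Borel probability measure on `ℝ^d` with finite second moment,
i.e. an element of `P_2(ℝ^d)`. -/
def IsP2 {d : ℕ} (μ : Measure (Ed d)) : Prop :=
  IsProbabilityMeasure μ ∧ Integrable (fun x => ‖x‖ ^ 2) μ

/-- The empirical measure `m_x^N = (1/N) ∑ δ_{x^i}`. -/
def empMeas {d N : ℕ} (x : Fin N → Ed d) : Measure (Ed d) :=
  (N : ℝ≥0∞)⁻¹ • ∑ i, Measure.dirac (x i)

/-- `π` is a coupling of `μ` and `ν`. -/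
def IsCoupling {d : ℕ} (π : Measure (Ed d × Ed d)) (μ ν : Measure (Ed d)) : Prop :=
  IsProbabilityMeasure π ∧ π.map Prod.fst = μ ∧ π.map Prod.snd = ν

/-- The squared 2-Wasserstein distance `d_2(μ,ν)²`, as the infimum over couplings of
`∫ |x - y|² dπ(x,y)` (with value in `[0,∞]`). -/
def d2sq {d : ℕ} (μ ν : Measure (Ed d)) : ℝ≥0∞ :=
  ⨅ (π : Measure (Ed d × Ed d)) (_ : IsCoupling π μ ν),
    ∫⁻ p, (‖p.1 - p.2‖₊ : ℝ≥0∞) ^ 2 ∂π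

/-- The 2-Wasserstein distance `d_2(μ,ν)`. -/
def d2 {d : ℕ} (μ ν : Measure (Ed d)) : ℝ := Real.sqrt (d2sq μ ν).toReal

/-- The 1-Wasserstein distance, via Kantorovich duality:
`d_1(μ,ν) = sup { ∫ f dμ - ∫ f dν : f 1-Lipschitz }`. -/
def d1 {d : ℕ} (μ ν : Measure (Ed d)) : ℝ :=
  sSup { r | ∃ f : Ed d → ℝ, LipschitzWith 1 f ∧ r = (∫ x, f x ∂μ) - ∫ x, f x ∂ν }

/-- The Hopf–Lax mean-field value function
`U(t,m) = inf_{ν ∈ P_2} { G(ν) + d_2(m,ν)²/(2(T-t)) }`. -/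
def MFval {d : ℕ} (T : ℝ) (G : Measure (Ed d) → ℝ) (t : ℝ) (m : Measure (Ed d)) : ℝ :=
  sInf { r | ∃ ν : Measure (Ed d), IsP2 ν ∧
    r = G ν + (d2sq m ν).toReal / (2 * (T - t)) }

/-- The Hopf–Lax `N`-particle value function
`V^N(t,x) = inf_y { G(m_y^N) + (1/(2(T-t)N)) ∑ |x^i - y^i|² }`. -/
def NPval {d N : ℕ} (T : ℝ) (G : Measure (Ed d) → ℝ) (t : ℝ) (x : Fin N → Ed d) : ℝ :=
  sInf { r | ∃ y : Fin N → Ed d,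
    r = G (empMeas y) + (1 / (2 * (T - t) * (N : ℝ))) * ∑ i, ‖x i - y i‖ ^ 2 }

lemma IsP2.integrable_of_lipschitzWith {d : ℕ} {μ : Measure (Ed d)} (hμ : IsP2 μ)
    {f : Ed d → ℝ} (hf : LipschitzWith 1 f) : Integrable f μ := by
  have := hμ.1
  refine Integrable.mono' (((integrable_const (|f 0| + 1)).add hμ.2))
    hf.continuous.aestronglyMeasurable (ae_of_all _ fun x => ?_)
  have h := hf.dist_le_mul x 0
  simp only [NNReal.coe_one, one_mul, dist_zero_right, Real.dist_eq] at h
  have h2 := abs_sub_abs_le_abs_sub (f x) (f 0)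
  simp only [Real.norm_eq_abs, Pi.add_apply]
  nlinarith [sq_nonneg (‖x‖ - 1), norm_nonneg x]

lemma IsCoupling.integrable_comp_fst {d : ℕ} {π : Measure (Ed d × Ed d)} {μ ν : Measure (Ed d)}
    (hπ : IsCoupling π μ ν) {f : Ed d → ℝ} (hf : Integrable f μ) :
    Integrable (fun p => f p.1) π := by
  obtain ⟨-, h1, -⟩ := hπ
  subst h1
  exact hf.comp_measurable measurable_fst

lemma IsCoupling.integrable_comp_snd {d : ℕ} {π : Measure (Ed d × Ed d)} {μ ν : Measure (Ed d)}
    (hπ : IsCoupling π μ ν) {f : Ed d → ℝ} (hf : Integrable f ν) :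
    Integrable (fun p => f p.2) π := by
  obtain ⟨-, -, h2⟩ := hπ
  subst h2
  exact hf.comp_measurable measurable_snd

lemma IsCoupling.integral_comp_fst {d : ℕ} {π : Measure (Ed d × Ed d)} {μ ν : Measure (Ed d)}
    (hπ : IsCoupling π μ ν) {f : Ed d → ℝ} (hf : Continuous f) :
    ∫ p, f p.1 ∂π = ∫ x, f x ∂μ := by
  obtain ⟨-, h1, -⟩ := hπ
  subst h1
  exact (integral_map measurable_fst.aemeasurable hf.aestronglyMeasurable).symm

lemma IsCoupling.integral_comp_snd {d : ℕ} {π : Measure (Ed d × Ed d)} {μ ν : Measure (Ed d)}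
    (hπ : IsCoupling π μ ν) {f : Ed d → ℝ} (hf : Continuous f) :
    ∫ p, f p.2 ∂π = ∫ x, f x ∂ν := by
  obtain ⟨-, -, h2⟩ := hπ
  subst h2
  exact (integral_map measurable_snd.aemeasurable hf.aestronglyMeasurable).symm

lemma IsCoupling.integrable_sq_norm_sub {d : ℕ} {π : Measure (Ed d × Ed d)}
    {μ ν : Measure (Ed d)} (hπ : IsCoupling π μ ν) (hμ : IsP2 μ) (hν : IsP2 ν) :
    Integrable (fun p => ‖p.1 - p.2‖ ^ 2) π := by
  refine Integrable.mono' (((hπ.integrable_comp_fst hμ.2).const_mul 2).add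
    ((hπ.integrable_comp_snd hν.2).const_mul 2))
    (by fun_prop) (ae_of_all _ fun p => ?_)
  have h := norm_sub_le p.1 p.2
  simp only [Real.norm_eq_abs, Pi.add_apply]
  rw [abs_of_nonneg (by positivity)]
  nlinarith [sq_nonneg (‖p.1‖ - ‖p.2‖), norm_nonneg (p.1 - p.2)]

lemma IsCoupling.cost_eq_ofReal {d : ℕ} {π : Measure (Ed d × Ed d)}
    {μ ν : Measure (Ed d)} (hπ : IsCoupling π μ ν) (hμ : IsP2 μ) (hν : IsP2 ν) :
    ∫⁻ p, (‖p.1 - p.2‖₊ : ℝ≥0∞) ^ 2 ∂π = ENNReal.ofReal (∫ p, ‖p.1 - p.2‖ ^ 2 ∂π) := by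
  rw [ofReal_integral_eq_lintegral_ofReal (hπ.integrable_sq_norm_sub hμ hν)
    (ae_of_all _ fun p => by positivity)]
  refine lintegral_congr fun p => ?_
  rw [ENNReal.ofReal_pow (norm_nonneg _), ofReal_norm, enorm_eq_nnnorm]

lemma IsCoupling.d2sq_le {d : ℕ} {π : Measure (Ed d × Ed d)} {μ ν : Measure (Ed d)}
    (hπ : IsCoupling π μ ν) : d2sq μ ν ≤ ∫⁻ p, (‖p.1 - p.2‖₊ : ℝ≥0∞) ^ 2 ∂π :=
  iInf₂_le π hπ

lemma IsCoupling.prod {d : ℕ} {μ ν : Measure (Ed d)} [IsProbabilityMeasure μ]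
    [IsProbabilityMeasure ν] : IsCoupling (μ.prod ν) μ ν :=
  ⟨inferInstance, by simp, by simp⟩

lemma d2sq_ne_top {d : ℕ} {μ ν : Measure (Ed d)} (hμ : IsP2 μ) (hν : IsP2 ν) :
    d2sq μ ν ≠ ∞ := by
  have := hμ.1
  have := hν.1
  refine ne_top_of_le_ne_top ?_ IsCoupling.prod.d2sq_le
  rw [IsCoupling.prod.cost_eq_ofReal hμ hν]
  exact ENNReal.ofReal_ne_top

lemma IsCoupling.sq_integral_sub_le {d : ℕ} {π : Measure (Ed d × Ed d)}
    {μ ν : Measure (Ed d)} (hπ : IsCoupling π μ ν) (hμ : IsP2 μ) (hν : IsP2 ν)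
    {f : Ed d → ℝ} (hf : LipschitzWith 1 f) :
    ((∫ x, f x ∂μ) - ∫ x, f x ∂ν) ^ 2 ≤ ∫ p, ‖p.1 - p.2‖ ^ 2 ∂π := by
  have := hπ.1
  have i1 := hπ.integrable_comp_fst (hμ.integrable_of_lipschitzWith hf)
  have i2 := hπ.integrable_comp_snd (hν.integrable_of_lipschitzWith hf)
  rw [← hπ.integral_comp_fst hf.continuous, ← hπ.integral_comp_snd hf.continuous,
    ← integral_sub i1 i2]
  set c := ∫ p, f p.1 - f p.2 ∂π with hc
  have i3 : Integrable (fun p => 2 * c * (f p.1 - f p.2)) π := (i1.sub i2).const_mul _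
  have h : ∫ p, (2 * c * (f p.1 - f p.2) - c ^ 2) ∂π ≤ ∫ p, ‖p.1 - p.2‖ ^ 2 ∂π := by
    refine integral_mono (i3.sub (integrable_const _))
      (hπ.integrable_sq_norm_sub hμ hν) fun p => ?_
    have h := hf.dist_le_mul p.1 p.2
    simp only [NNReal.coe_one, one_mul, dist_eq_norm] at h
    have h' := pow_le_pow_left₀ (norm_nonneg _) h 2
    rw [Real.norm_eq_abs, sq_abs] at h'
    simp only
    nlinarith [sq_nonneg (f p.1 - f p.2 - c)]
  rw [integral_sub i3 (integrable_const _), integral_const_mul, ← hc] at h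
  simp only [integral_const, probReal_univ, one_smul] at h
  linarith

lemma integral_sub_le_d2 {d : ℕ} {μ ν : Measure (Ed d)} (hμ : IsP2 μ) (hν : IsP2 ν)
    {f : Ed d → ℝ} (hf : LipschitzWith 1 f) :
    (∫ x, f x ∂μ) - ∫ x, f x ∂ν ≤ d2 μ ν := by
  refine Real.le_sqrt_of_sq_le ?_
  rw [← ENNReal.ofReal_le_iff_le_toReal (d2sq_ne_top hμ hν)]
  refine le_iInf₂ fun π hπ => ?_
  rw [hπ.cost_eq_ofReal hμ hν]
  exact ENNReal.ofReal_le_ofReal (hπ.sq_integral_sub_le hμ hν hf)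

lemma d1_le_d2 {d : ℕ} {μ ν : Measure (Ed d)} (hμ : IsP2 μ) (hν : IsP2 ν) :
    d1 μ ν ≤ d2 μ ν := by
  refine csSup_le ⟨_, fun _ => 0, LipschitzWith.const' 0, rfl⟩ ?_
  rintro r ⟨f, hf, rfl⟩
  exact integral_sub_le_d2 hμ hν hf

lemma integral_sub_le_d1 {d : ℕ} {μ ν : Measure (Ed d)} (hμ : IsP2 μ) (hν : IsP2 ν)
    {f : Ed d → ℝ} (hf : LipschitzWith 1 f) :
    (∫ x, f x ∂μ) - ∫ x, f x ∂ν ≤ d1 μ ν := by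
  refine le_csSup ⟨d2 μ ν, ?_⟩ ⟨f, hf, rfl⟩
  rintro r ⟨g, hg, rfl⟩
  exact integral_sub_le_d2 hμ hν hg

lemma isP2_dirac {d : ℕ} (a : Ed d) : IsP2 (Measure.dirac a) :=
  ⟨inferInstance, integrable_dirac (by simp)⟩

lemma d2_sq {d : ℕ} (μ ν : Measure (Ed d)) : d2 μ ν ^ 2 = (d2sq μ ν).toReal :=
  Real.sq_sqrt ENNReal.toReal_nonneg

lemma isProbabilityMeasure_average_dirac {α : Type*} [MeasurableSpace α] {N : ℕ} (hN : 1 ≤ N)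
    (x : Fin N → α) :
    IsProbabilityMeasure ((N : ℝ≥0∞)⁻¹ • ∑ i, Measure.dirac (x i)) := by
  refine ⟨?_⟩
  simp only [Measure.smul_apply, Measure.finsetSum_apply, measure_univ, smul_eq_mul,
    Finset.sum_const, Finset.card_univ, Fintype.card_fin, nsmul_eq_mul, mul_one]
  exact ENNReal.inv_mul_cancel (by exact_mod_cast (by omega : N ≠ 0)) (ENNReal.natCast_ne_top N)

lemma isP2_empMeas {d N : ℕ} (hN : 1 ≤ N) (x : Fin N → Ed d) : IsP2 (empMeas x) := by
  refine ⟨isProbabilityMeasure_average_dirac hN x, Integrable.smul_measure ?_ ?_⟩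
  · exact integrable_finsetSum_measure.2 fun i _ => (isP2_dirac (x i)).2
  · exact ENNReal.inv_ne_top.2 (by exact_mod_cast (by omega : N ≠ 0))

lemma isCoupling_average_dirac {d N : ℕ} (hN : 1 ≤ N) (x y : Fin N → Ed d) :
    IsCoupling ((N : ℝ≥0∞)⁻¹ • ∑ i, Measure.dirac (x i, y i)) (empMeas x) (empMeas y) := by
  refine ⟨isProbabilityMeasure_average_dirac hN fun i => (x i, y i), ?_, ?_⟩
  · rw [Measure.map_smul, Measure.map_finset_sum measurable_fst.aemeasurable]
    simp [empMeas, Measure.map_dirac' measurable_fst]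
  · rw [Measure.map_smul, Measure.map_finset_sum measurable_snd.aemeasurable]
    simp [empMeas, Measure.map_dirac' measurable_snd]

lemma toReal_d2sq_empMeas_le {d N : ℕ} (hN : 1 ≤ N) (x y : Fin N → Ed d) :
    (d2sq (empMeas x) (empMeas y)).toReal ≤ (N : ℝ)⁻¹ * ∑ i, ‖x i - y i‖ ^ 2 := by
  refine ENNReal.toReal_le_of_le_ofReal (by positivity) ?_
  refine (isCoupling_average_dirac hN x y).d2sq_le.trans_eq ?_
  rw [(isCoupling_average_dirac hN x y).cost_eq_ofReal (isP2_empMeas hN x) (isP2_empMeas hN y),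
    integral_smul_measure, integral_finsetSum_measure fun i _ => integrable_dirac (by simp)]
  simp

lemma toReal_d2sq_empMeas_self {d N : ℕ} (hN : 1 ≤ N) (x : Fin N → Ed d) :
    (d2sq (empMeas x) (empMeas x)).toReal = 0 :=
  le_antisymm (by simpa using toReal_d2sq_empMeas_le hN x x) ENNReal.toReal_nonneg

lemma lipschitz_const_nonneg {d : ℕ} (hd : 1 ≤ d) {G : Measure (Ed d) → ℝ} {L : ℝ}
    (hG : ∀ μ ν : Measure (Ed d), IsP2 μ → IsP2 ν → |G μ - G ν| ≤ L * d1 μ ν) : 0 ≤ L := by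
  let a : Ed d := EuclideanSpace.single ⟨0, hd⟩ 1
  have h1 := hG _ _ (isP2_dirac a) (isP2_dirac 0)
  have h2 := integral_sub_le_d1 (isP2_dirac a) (isP2_dirac 0) lipschitzWith_one_norm
  simp only [integral_dirac, norm_zero, sub_zero] at h2
  have ha : ‖a‖ = 1 := by simp [a]
  rw [ha] at h2
  exact nonneg_of_mul_nonneg_left ((abs_nonneg _).trans h1) (by linarith)

/-- Lower bound for the Hopf–Lax functional. -/
lemma sub_le_hopfLax {d : ℕ} {G : Measure (Ed d) → ℝ} {L τ : ℝ} (hL : 0 ≤ L) (hτ : 0 < τ)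
    (hG : ∀ μ ν : Measure (Ed d), IsP2 μ → IsP2 ν → |G μ - G ν| ≤ L * d1 μ ν)
    {μ ν : Measure (Ed d)} (hμ : IsP2 μ) (hν : IsP2 ν) :
    G μ - L ^ 2 * τ / 2 ≤ G ν + (d2sq μ ν).toReal / (2 * τ) := by
  have h1 := (le_abs_self _).trans (hG μ ν hμ hν)
  have h2 := mul_le_mul_of_nonneg_left (d1_le_d2 hμ hν) hL
  have h3 : L * d2 μ ν - L ^ 2 * τ / 2 ≤ d2 μ ν ^ 2 / (2 * τ) := by
    rw [le_div_iff₀ (by positivity)]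
    nlinarith [sq_nonneg (d2 μ ν - L * τ)]
  rw [← d2_sq]
  linarith

/-- for `G` Lipschitz wrt `d_1` with constant `L_G`, any minimizer `ν̄` in
the Hopf–Lax formula for `U(t, m_x^N)` satisfies `d_2(m_x^N, ν̄) ≤ 2 L_G (T-t)`, and moreover
`V^N(t,x) ≤ U(t, m_x^N) + 2 L_G² (T-t)`. -/
theorem minimizer_dist_bound_and_value_bound {d N : ℕ} (hd : 1 ≤ d) (hN : 1 ≤ N)
    (T : ℝ) (hT : 0 < T)
    (G : Measure (Ed d) → ℝ) (LG : ℝ)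
    (hGlip : ∀ μ ν : Measure (Ed d), IsP2 μ → IsP2 ν → |G μ - G ν| ≤ LG * d1 μ ν)
    (t : ℝ) (ht : 0 ≤ t) (htT : t < T) (x : Fin N → Ed d)
    (νb : Measure (Ed d)) (hνb : IsP2 νb)
    (hmin : G νb + (d2sq (empMeas x) νb).toReal / (2 * (T - t)) = MFval T G t (empMeas x)) :
    d2 (empMeas x) νb ≤ 2 * LG * (T - t) ∧
    NPval T G t x ≤ MFval T G t (empMeas x) + 2 * LG ^ 2 * (T - t) := by
  have hτ : 0 < T - t := sub_pos.2 htT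
  have hL := lipschitz_const_nonneg hd hGlip
  have hm := isP2_empMeas hN x
  have hU : MFval T G t (empMeas x) ≤ G (empMeas x) := by
    refine csInf_le ⟨G (empMeas x) - LG ^ 2 * (T - t) / 2, ?_⟩
      ⟨empMeas x, hm, by rw [toReal_d2sq_empMeas_self hN]; simp⟩
    rintro r ⟨ν, hν, rfl⟩
    exact sub_le_hopfLax hL hτ hGlip hm hν
  have hV : NPval T G t x ≤ G (empMeas x) := by
    refine csInf_le ⟨G (empMeas x) - LG ^ 2 * (T - t) / 2, ?_⟩ ⟨x, by simp⟩
    rintro r ⟨y, rfl⟩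
    refine (sub_le_hopfLax hL hτ hGlip hm (isP2_empMeas hN y)).trans ?_
    have h := toReal_d2sq_empMeas_le hN x y
    have h' := div_le_div_of_nonneg_right h (by positivity : 0 ≤ 2 * (T - t))
    refine (add_le_add_right h' _).trans_eq ?_
    rw [one_div, mul_inv]
    ring
  have hdiff : G (empMeas x) - G νb ≤ LG * d2 (empMeas x) νb :=
    ((le_abs_self _).trans (hGlip _ _ hm hνb)).trans
      (mul_le_mul_of_nonneg_left (d1_le_d2 hm hνb) hL)
  have hdist : d2 (empMeas x) νb ≤ 2 * LG * (T - t) := by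
    have h : d2 (empMeas x) νb ^ 2 / (2 * (T - t)) ≤ LG * d2 (empMeas x) νb := by
      rw [d2_sq]
      linarith
    rw [div_le_iff₀ (by positivity)] at h
    have hd2 : 0 ≤ d2 (empMeas x) νb := Real.sqrt_nonneg _
    rcases hd2.eq_or_lt with h0 | h0
    · rw [← h0]
      positivity
    · refine le_of_mul_le_mul_left ?_ h0
      linarith
  refine ⟨hdist, ?_⟩
  have hcost : 0 ≤ (d2sq (empMeas x) νb).toReal / (2 * (T - t)) := by positivity
  have h := mul_le_mul_of_nonneg_left hdist hL
  linarith

end
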